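/- Let $\phi:\omega\to\mathbb{R}$ be a bounded continuous distributional solution of $\partial_z\phi+\partial_t(\phi^2/2)=w$ on an open set $\omega\subset\mathbb{R}^2$, with $w\in L^\infty(\omega)$. Let $\gamma:[a,b]\to\mathbb{R}$ be $C^1$ with $(s,\gamma(s))\in\omega$ and $\dot\gamma(s)=\phi(s,\gamma(s))$ for all $s$. Then $s\mapsto\phi(s,\gamma(s))$ is Lipschitz with constant $\|w\|_{L^\infty(\omega)}$: $|\phi(b',\gamma(b'))-\phi(a',\gamma(a'))|\le\|w\|_{L^\infty}\,|b'-a'|$ for all $a',b'\in[a,b]$. -/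

import Mathlib

open Set Real MeasureTheory

lemma prim_smooth (k : ℝ → ℝ) (hk : ContDiff ℝ (⊤ : ℕ∞) k) (a : ℝ) :
    ContDiff ℝ (⊤ : ℕ∞) (fun x => ∫ t in a..x, k t) ∧
    ∀ x, HasDerivAt (fun x => ∫ t in a..x, k t) (k x) x := by
  have h : ∀ x, HasDerivAt (fun x => ∫ t in a..x, k t) (k x) x := fun x =>
    intervalIntegral.integral_hasDerivAt_right (hk.continuous.intervalIntegrable _ _)
      (hk.continuous.stronglyMeasurableAtFilter _ _) hk.continuous.continuousAt
  refine ⟨?_, h⟩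
  rw [contDiff_infty_iff_deriv]
  refine ⟨fun x => (h x).differentiableAt, ?_⟩
  have : deriv (fun x => ∫ t in a..x, k t) = k := funext fun x => (h x).deriv
  rw [this]; exact hk

lemma exists_kernel (h : ℝ) (hh : 0 < h) : ∃ k : ℝ → ℝ, ContDiff ℝ (⊤ : ℕ∞) k ∧ (∀ x, 0 ≤ k x) ∧
    (∀ x, k x ≠ 0 → 0 ≤ x ∧ x ≤ h) ∧ HasCompactSupport k ∧ ∫ x, k x = 1 := by
  let B : ContDiffBump (h/2 : ℝ) := ⟨h/4, h/2, by linarith, by linarith⟩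
  refine ⟨B.normed volume, B.contDiff_normed, fun x => B.nonneg_normed x, ?_,
    B.hasCompactSupport_normed, B.integral_normed⟩
  intro x hx
  have : x ∈ Function.support (B.normed volume) := hx
  rw [B.support_normed_eq, Metric.mem_ball, Real.dist_eq, abs_lt] at this
  change -(h/2) < _ ∧ _ < h/2 at this
  constructor <;> linarith [this.1, this.2]

lemma exists_plateau (h : ℝ) (k : ℝ → ℝ) (hk : ContDiff ℝ (⊤ : ℕ∞) k)
    (hk0 : ∀ x, 0 ≤ k x) (hks : ∀ x, k x ≠ 0 → 0 ≤ x ∧ x ≤ h)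
    (hk1 : ∫ x, k x = 1) (c d : ℝ) (hcd : c ≤ d) :
    ∃ χ : ℝ → ℝ, ContDiff ℝ (⊤ : ℕ∞) χ ∧ (∀ x, 0 ≤ χ x) ∧
      (∀ x, HasDerivAt χ (k (x - c) - k (x - d)) x) ∧
      (∀ x, χ x ≠ 0 → c ≤ x ∧ x ≤ d + h) ∧ HasCompactSupport χ ∧ ∫ x, χ x = d - c := by
  obtain ⟨hG, hG'⟩ := prim_smooth k hk 0
  set G : ℝ → ℝ := fun x => ∫ t in (0:ℝ)..x, k t with hGdef
  have hint : ∀ u v : ℝ, IntervalIntegrable k volume u v :=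
    fun u v => hk.continuous.intervalIntegrable _ _
  have e1 : ∀ x, G (x - c) - G (x - d) = ∫ t in (x-d)..(x-c), k t := fun x =>
    intervalIntegral.integral_interval_sub_left (hint _ _) (hint _ _)
  have e2 : ∀ x, G (x - c) - G (x - d) = ∫ s in c..d, k (x - s) := by
    intro x; rw [e1, intervalIntegral.integral_comp_sub_left]
  have supp : ∀ x, G (x - c) - G (x - d) ≠ 0 → c ≤ x ∧ x ≤ d + h := by
    intro x hx
    by_contra hcon
    apply hx
    rw [e1]
    have : ∀ t ∈ uIcc (x-d) (x-c), k t = 0 ∨ t = 0 ∨ t = h := by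
      intro t ht
      rw [uIcc_of_le (by linarith)] at ht
      by_contra hc
      push Not at hc
      have := hks t hc.1
      apply hcon
      constructor <;> linarith [ht.1, ht.2]
    rw [intervalIntegral.integral_congr (g := fun _ => 0)]
    · simp
    · intro t ht
      rw [uIcc_of_le (by linarith)] at ht
      by_contra hc
      have := hks t hc
      apply hcon
      constructor <;> linarith [ht.1, ht.2]
  refine ⟨fun x => G (x - c) - G (x - d), ?_, ?_, ?_, supp, ?_, ?_⟩
  · exact (hG.comp (contDiff_id.sub contDiff_const)).sub (hG.comp (contDiff_id.sub contDiff_const))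
  · intro x
    simp only [e2]
    exact intervalIntegral.integral_nonneg hcd fun s _ => hk0 _
  · intro x
    exact ((hG' (x - c)).comp_sub_const x c).sub ((hG' (x - d)).comp_sub_const x d)
  · refine HasCompactSupport.of_support_subset_isCompact (isCompact_Icc (a := c) (b := d + h)) ?_
    intro x hx; exact supp x hx
  · simp only [e2]
    simp only [intervalIntegral.integral_of_le hcd]
    rw [integral_integral_swap]
    · have : ∀ s : ℝ, ∫ x, k (x - s) = 1 := fun s => by
        rw [integral_sub_right_eq_self (μ := volume) k s, hk1]
      simp only [this]
      simp [hcd]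
    · have hc : Continuous (fun p : ℝ × ℝ => k (p.1 - p.2)) := hk.continuous.comp (by fun_prop)
      have : IntegrableOn (fun p : ℝ × ℝ => k (p.1 - p.2)) (univ ×ˢ Ioc c d) := by
        have h1 : IntegrableOn (fun p : ℝ × ℝ => k (p.1 - p.2)) (Icc c (d+h) ×ˢ Icc c d) :=
          hc.continuousOn.integrableOn_compact (isCompact_Icc.prod isCompact_Icc)
        have h2 : IntegrableOn (fun p : ℝ × ℝ => k (p.1 - p.2)) (univ ×ˢ Icc c d) := by
          refine h1.of_forall_sdiff_eq_zero (MeasurableSet.univ.prod measurableSet_Icc) ?_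
          rintro ⟨x, s⟩ ⟨hx1, hx2⟩
          by_contra hne
          have := hks _ hne
          apply hx2
          simp only [mem_prod, mem_univ, mem_Icc, true_and] at hx1 ⊢
          refine ⟨⟨?_, ?_⟩, hx1⟩ <;> linarith [hx1.1, hx1.2, this.1, this.2]
        exact h2.mono_set (prod_mono le_rfl Ioc_subset_Icc_self)
      rw [IntegrableOn, Measure.volume_eq_prod, ← Measure.prod_restrict, Measure.restrict_univ] at this
      exact this

lemma exists_smooth_approx (a b : ℝ) (hab : a ≤ b) (γ f : ℝ → ℝ) (hf : ContinuousOn f (Icc a b))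
    (hγ : ∀ s ∈ Icc a b, HasDerivAt γ (f s) s) (δ : ℝ) (hδ : 0 < δ) :
    ∃ g g' : ℝ → ℝ, ContDiff ℝ (⊤ : ℕ∞) g ∧ Continuous g' ∧ (∀ x, HasDerivAt g (g' x) x) ∧
      ∀ x ∈ Icc a b, |g' x - f x| ≤ δ ∧ |g x - γ x| ≤ δ * (b - a) := by
  obtain ⟨P, hP⟩ := exists_polynomial_near_of_continuousOn a b f hf δ hδ
  have hPs : ContDiff ℝ (⊤ : ℕ∞) (fun x => P.eval x) := by
    simpa using P.contDiff_aeval (𝕜 := ℝ) (⊤ : ℕ∞)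
  obtain ⟨hG, hG'⟩ := prim_smooth _ hPs a
  refine ⟨fun x => γ a + ∫ t in a..x, P.eval t, fun x => P.eval x, contDiff_const.add hG,
    hPs.continuous, fun x => by simpa using (hG' x).const_add (γ a), ?_⟩
  intro x hx
  refine ⟨(hP x hx).le, ?_⟩
  have := Convex.norm_image_sub_le_of_norm_hasDerivWithin_le (𝕜 := ℝ)
    (f := fun x => γ a + (∫ t in a..x, P.eval t) - γ x) (f' := fun x => P.eval x - f x)
    (s := Icc a b) (C := δ) (x := a) (y := x)
    (fun y hy => (((hG' y).const_add (γ a)).sub (hγ y hy)).hasDerivWithinAt)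
    (fun y hy => (hP y hy).le) (convex_Icc a b) (left_mem_Icc.2 hab) hx
  simp only [intervalIntegral.integral_same, add_zero, sub_self, sub_zero, Real.norm_eq_abs] at this
  refine this.trans ?_
  rw [abs_of_nonneg (by linarith [hx.1])]
  gcongr; exact hx.2

lemma exists_modulus (a b : ℝ) (Φ : ℝ × ℝ → ℝ) (hΦ : Continuous Φ) (γ : ℝ → ℝ)
    (hγ : ContinuousOn γ (Icc a b)) (κ : ℝ) (hκ : 0 < κ) :
    ∃ ρ > 0, ∀ z ∈ Icc a b, ∀ t, |t - γ z| ≤ ρ → |Φ (z, t) - Φ (z, γ z)| ≤ κ := by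
  have hC : IsCompact ((fun z => (z, γ z)) '' Icc a b) :=
    isCompact_Icc.image_of_continuousOn (continuousOn_id.prodMk hγ)
  have := hC.uniformContinuousAt_of_continuousAt Φ (fun x _ => hΦ.continuousAt)
    (Metric.dist_mem_uniformity hκ)
  obtain ⟨ρ, hρ, H⟩ := Metric.mem_uniformity_dist.1 this
  refine ⟨ρ/2, by positivity, fun z hz t ht => ?_⟩
  have h1 : dist ((z, γ z) : ℝ × ℝ) (z, t) < ρ := by
    rw [Prod.dist_eq]; simp only [dist_self, Real.dist_eq]
    rw [abs_sub_comm] at ht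
    exact max_lt hρ (by linarith)
  have h2 := H h1 (mem_image_of_mem _ hz)
  simp only [mem_ofPred_eq, Real.dist_eq] at h2
  rw [abs_sub_comm]; exact h2.le

lemma shear (g : ℝ → ℝ) (hg : Continuous g) (F : ℝ × ℝ → ℝ) (hF : Continuous F)
    (hFc : HasCompactSupport F) :
    ∫ p, F p = ∫ p : ℝ × ℝ, F (p.1, p.2 + g p.1) := by
  let e : ℝ × ℝ ≃ₜ ℝ × ℝ :=
    { toFun := fun p => (p.1, p.2 + g p.1)
      invFun := fun p => (p.1, p.2 - g p.1)
      left_inv := fun p => by simp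
      right_inv := fun p => by simp
      continuous_toFun := by fun_prop
      continuous_invFun := by fun_prop }
  have hc2 : HasCompactSupport (fun p : ℝ × ℝ => F (p.1, p.2 + g p.1)) :=
    hFc.comp_homeomorph e
  rw [Measure.volume_eq_prod, integral_prod, integral_prod]
  · congr 1; ext x
    exact (integral_add_right_eq_self (μ := volume) (fun t => F (x, t)) (g x)).symm
  · exact (by fun_prop : Continuous _).integrable_of_hasCompactSupport hc2
  · exact hF.integrable_of_hasCompactSupport hFc

lemma wint (U : ℝ × ℝ → ℝ) (hU : Continuous U) (A B : ℝ → ℝ) (hA : Continuous A)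
    (hB : Continuous B) (hAc : HasCompactSupport A) (hBc : HasCompactSupport B) :
    Integrable (fun p : ℝ × ℝ => U p * (A p.1 * B p.2)) := by
  refine Continuous.integrable_of_hasCompactSupport (by fun_prop) ?_
  refine HasCompactSupport.of_support_subset_isCompact (hAc.isCompact.prod hBc.isCompact) ?_
  intro p hp
  have : U p * (A p.1 * B p.2) ≠ 0 := hp
  refine ⟨subset_tsupport _ ?_, subset_tsupport _ ?_⟩
  · intro h0; simp [h0] at this
  · intro h0; simp [h0] at this

lemma wmass (A B : ℝ → ℝ) (v : ℝ) :
    ∫ p : ℝ × ℝ, v * (A p.1 * B p.2) = v * ((∫ x, A x) * ∫ x, B x) := by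
  rw [integral_const_mul, Measure.volume_eq_prod, integral_prod_mul]

lemma wavg (U : ℝ × ℝ → ℝ) (hU : Continuous U) (A B : ℝ → ℝ) (hA : Continuous A)
    (hB : Continuous B) (hAc : HasCompactSupport A) (hBc : HasCompactSupport B)
    (hA0 : ∀ x, 0 ≤ A x) (hB0 : ∀ x, 0 ≤ B x) (v κ : ℝ)
    (H : ∀ x y, A x ≠ 0 → B y ≠ 0 → |U (x, y) - v| ≤ κ) :
    |(∫ p : ℝ × ℝ, U p * (A p.1 * B p.2)) - v * ((∫ x, A x) * ∫ x, B x)|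
      ≤ κ * ((∫ x, A x) * ∫ x, B x) := by
  rw [← wmass, ← wmass, ← integral_sub (wint U hU A B hA hB hAc hBc)
    (wint (fun _ => v) continuous_const A B hA hB hAc hBc), ← Real.norm_eq_abs]
  refine norm_integral_le_of_norm_le (wint (fun _ => κ) continuous_const A B hA hB hAc hBc) ?_
  refine Filter.Eventually.of_forall fun p => ?_
  have h0 : 0 ≤ A p.1 * B p.2 := mul_nonneg (hA0 _) (hB0 _)
  rw [← sub_mul, norm_mul, Real.norm_eq_abs, Real.norm_eq_abs, abs_of_nonneg h0]
  by_cases h1 : A p.1 = 0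
  · simp [h1]
  by_cases h2 : B p.2 = 0
  · simp [h2]
  exact mul_le_mul_of_nonneg_right (H p.1 p.2 h1 h2) h0

lemma fderiv_test (η η' χ χ' g g' : ℝ → ℝ) (hη : ∀ x, HasDerivAt η (η' x) x)
    (hχ : ∀ x, HasDerivAt χ (χ' x) x) (hg : ∀ x, HasDerivAt g (g' x) x) (p : ℝ × ℝ) :
    fderiv ℝ (fun p : ℝ × ℝ => η p.1 * χ (p.2 - g p.1)) p (1, 0)
      = η' p.1 * χ (p.2 - g p.1) - η p.1 * (χ' (p.2 - g p.1) * g' p.1) ∧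
    fderiv ℝ (fun p : ℝ × ℝ => η p.1 * χ (p.2 - g p.1)) p (0, 1)
      = η p.1 * χ' (p.2 - g p.1) := by
  have h1 : HasFDerivAt (fun p : ℝ × ℝ => η p.1) (η' p.1 • ContinuousLinearMap.fst ℝ ℝ ℝ) p :=
    (hη p.1).comp_hasFDerivAt p hasFDerivAt_fst
  have h2 : HasFDerivAt (fun p : ℝ × ℝ => g p.1) (g' p.1 • ContinuousLinearMap.fst ℝ ℝ ℝ) p :=
    (hg p.1).comp_hasFDerivAt p hasFDerivAt_fst
  have h3 : HasFDerivAt (fun p : ℝ × ℝ => χ (p.2 - g p.1)) (χ' (p.2 - g p.1) •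
      (ContinuousLinearMap.snd ℝ ℝ ℝ - g' p.1 • ContinuousLinearMap.fst ℝ ℝ ℝ)) p :=
    (hχ (p.2 - g p.1)).comp_hasFDerivAt p (hasFDerivAt_snd.sub h2)
  have h4 : HasFDerivAt (fun p : ℝ × ℝ => η p.1 * χ (p.2 - g p.1)) _ p := h1.mul h3
  rw [h4.fderiv]
  constructor
  · simp; ring
  · simp

lemma int6 (G F1 F2 F3 F4 F5 F6 : ℝ × ℝ → ℝ) (i1 : Integrable F1) (i2 : Integrable F2)
    (i3 : Integrable F3) (i4 : Integrable F4) (i5 : Integrable F5) (i6 : Integrable F6)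
    (h : ∀ p, G p = F1 p - F2 p + F3 p - F4 p - (F5 p - F6 p)) :
    ∫ p, G p = (∫ p, F1 p) - (∫ p, F2 p) + (∫ p, F3 p) - (∫ p, F4 p)
      - ((∫ p, F5 p) - ∫ p, F6 p) := by
  have : G = F1 - F2 + F3 - F4 - (F5 - F6) := funext h
  rw [this, integral_sub' (((i1.sub i2).add i3).sub i4) (i5.sub i6),
    integral_sub' ((i1.sub i2).add i3) i4, integral_add' (i1.sub i2) i3, integral_sub' i1 i2,
    integral_sub' i5 i6]

lemma ident (Φ : ℝ × ℝ → ℝ) (hΦ : Continuous Φ) (η χ g g' k : ℝ → ℝ) (a b c d : ℝ)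
    (hηs : ContDiff ℝ (⊤ : ℕ∞) η) (hχs : ContDiff ℝ (⊤ : ℕ∞) χ)
    (hgs : ContDiff ℝ (⊤ : ℕ∞) g) (hg'c : Continuous g')
    (hk : Continuous k) (hkc : HasCompactSupport k)
    (hη : ∀ x, HasDerivAt η (k (x - a) - k (x - b)) x)
    (hχ : ∀ x, HasDerivAt χ (k (x - c) - k (x - d)) x) (hg : ∀ x, HasDerivAt g (g' x) x)
    (hηc : HasCompactSupport η) (hχc : HasCompactSupport χ)
    (ψ : ℝ × ℝ → ℝ) (hψ : ψ = fun p : ℝ × ℝ => η p.1 * χ (p.2 - g p.1)) 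
    (hψs : ContDiff ℝ (⊤ : ℕ∞) ψ) (hψc : HasCompactSupport ψ) :
    ∫ p, (Φ p * fderiv ℝ ψ p (1, 0) + (Φ p)^2 / 2 * fderiv ℝ ψ p (0, 1))
    = (∫ p : ℝ × ℝ, Φ (p.1, p.2 + g p.1) * (k (p.1 - a) * χ p.2))
      - (∫ p : ℝ × ℝ, Φ (p.1, p.2 + g p.1) * (k (p.1 - b) * χ p.2))
      + (∫ p : ℝ × ℝ, ((Φ (p.1, p.2 + g p.1) - g' p.1)^2 / 2) * (η p.1 * k (p.2 - c)))
      - (∫ p : ℝ × ℝ, ((Φ (p.1, p.2 + g p.1) - g' p.1)^2 / 2) * (η p.1 * k (p.2 - d))) := by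
  have hgc := hgs.continuous
  have hηcont := hηs.continuous
  have hχcont := hχs.continuous
  have hfc : Continuous (fderiv ℝ ψ) := hψs.continuous_fderiv (by simp)
  have hfcs : HasCompactSupport (fderiv ℝ ψ) := hψc.fderiv ℝ
  rw [shear g hgc _ (by fun_prop)]
  swap
  · refine hfcs.mono ?_
    intro p hp h0
    apply hp
    simp [h0]
  have kc : ∀ s, HasCompactSupport (fun x => k (x - s)) := fun s => by
    exact hkc.comp_homeomorph (Homeomorph.subRight s)
  have kcont : ∀ s, Continuous (fun x => k (x - s)) := fun s => by fun_prop
  have kint : ∀ s, ∫ x, k (x - s) = ∫ x, k x := fun s => integral_sub_right_eq_self k s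
  have hUc : Continuous (fun p : ℝ × ℝ => Φ (p.1, p.2 + g p.1)) := by fun_prop
  have hVc : Continuous (fun p : ℝ × ℝ => (Φ (p.1, p.2 + g p.1) - g' p.1)^2 / 2) := by fun_prop
  have hηg : Continuous (fun x => η x * (g' x)^2 / 2) := by fun_prop
  have hηgc : HasCompactSupport (fun x => η x * (g' x)^2 / 2) := by
    refine hηc.mono ?_
    intro p hp h0
    apply hp
    simp [h0]
  have i1 := wint _ hUc _ _ (kcont a) hχcont (kc a) hχc
  have i2 := wint _ hUc _ _ (kcont b) hχcont (kc b) hχc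
  have i3 := wint _ hVc _ _ hηcont (kcont c) hηc (kc c)
  have i4 := wint _ hVc _ _ hηcont (kcont d) hηc (kc d)
  have i5 := wint (fun _ => 1) continuous_const _ _ hηg (kcont c) hηgc (kc c)
  have i6 := wint (fun _ => 1) continuous_const _ _ hηg (kcont d) hηgc (kc d)
  have e5 := wmass (fun x => η x * (g' x)^2 / 2) (fun x => k (x - c)) 1
  have e6 := wmass (fun x => η x * (g' x)^2 / 2) (fun x => k (x - d)) 1
  rw [kint] at e5 e6
  rw [int6 _ _ _ _ _ _ _ i1 i2 i3 i4 i5 i6, e5, e6]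
  · ring
  · intro p
    subst hψ
    obtain ⟨d1, d2⟩ := fderiv_test η _ χ _ g g' hη hχ hg (p.1, p.2 + g p.1)
    rw [d1, d2]
    simp only [add_sub_cancel_right]
    ring

lemma core_eps (Φ : ℝ × ℝ → ℝ) (hΦ : Continuous Φ) (W : ℝ) (hW : 0 ≤ W) (a b : ℝ) (hab : a < b)
    (γ : ℝ → ℝ) (hγ : ∀ s ∈ Icc a b, HasDerivAt γ (Φ (s, γ s)) s) (r : ℝ) (hr : 0 < r)
    (H : ∀ ψ : ℝ × ℝ → ℝ, ContDiff ℝ (⊤ : ℕ∞) ψ → (∀ p, 0 ≤ ψ p) →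
      (∀ p ∈ tsupport ψ, p.1 ∈ Icc a b ∧ |p.2 - γ p.1| ≤ r) →
      |∫ p, (Φ p * fderiv ℝ ψ p (1, 0) + (Φ p)^2 / 2 * fderiv ℝ ψ p (0, 1))| ≤ W * ∫ p, ψ p)
    (κ : ℝ) (hκ : 0 < κ) :
    |Φ (b, γ b) - Φ (a, γ a)| ≤ W * (b - a) + κ * (2 + (b - a)) := by
  have hba : 0 < b - a := by linarith
  have hγc : ContinuousOn γ (Icc a b) := fun s hs => (hγ s hs).continuousAt.continuousWithinAt
  have hfc : ContinuousOn (fun s => Φ (s, γ s)) (Icc a b) :=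
    hΦ.comp_continuousOn (continuousOn_id.prodMk hγc)
  obtain ⟨ρ₁, hρ₁, H₁⟩ := exists_modulus a b Φ hΦ γ hγc (κ/2) (by positivity)
  obtain ⟨ε, hε, hε1, hε2⟩ : ∃ ε > 0, 3 * ε ≤ ρ₁ ∧ 3 * ε ≤ r :=
    ⟨min ρ₁ r / 3, by positivity, by linarith [min_le_left ρ₁ r], by linarith [min_le_right ρ₁ r]⟩
  obtain ⟨σ, hσ, hσ2⟩ : ∃ σ > 0, σ ^ 2 / 2 ≤ κ * ε :=
    ⟨√(κ * ε), by positivity, by rw [Real.sq_sqrt (by positivity)]; linarith [mul_pos hκ hε]⟩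
  obtain ⟨ρ₂, hρ₂, H₂⟩ := exists_modulus a b Φ hΦ γ hγc (σ/2) (by positivity)
  -- endpoints
  obtain ⟨h₁, hh₁, H₃⟩ := Metric.continuousOn_iff.1 hfc a (left_mem_Icc.2 hab.le) (κ/2) (by positivity)
  obtain ⟨h₂, hh₂, H₄⟩ := Metric.continuousOn_iff.1 hfc b (right_mem_Icc.2 hab.le) (κ/2) (by positivity)
  obtain ⟨h, hh, ha1, ha2, ha3, ha4, ha5⟩ : ∃ h > 0, h < h₁ ∧ h < h₂ ∧ h ≤ ε ∧ h ≤ ρ₂ / 2 ∧ h ≤ b - a := by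
    have hp : 0 < min h₁ (min h₂ (min ε (min (ρ₂/2) (b - a)))) := by positivity
    refine ⟨min h₁ (min h₂ (min ε (min (ρ₂/2) (b - a)))) / 2, by positivity, ?_, ?_, ?_, ?_, ?_⟩ <;>
      generalize hm : min h₁ (min h₂ (min ε (min (ρ₂/2) (b - a)))) = m at * <;>
      have := hm.ge <;> simp only [le_min_iff] at this <;> linarith [this.1, this.2.1, this.2.2.1, this.2.2.2.1, this.2.2.2.2]
  obtain ⟨δ, hδ, hδ1, hδ2, hδ3⟩ : ∃ δ > 0, δ ≤ σ / 2 ∧ δ * (b - a) ≤ ρ₂ / 2 ∧ δ * (b - a) ≤ ε := by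
    have hp : 0 < min (σ/2) (min (ρ₂/2/(b-a)) (ε/(b-a))) := by positivity
    refine ⟨_, hp, min_le_left _ _, ?_, ?_⟩
    · rw [← le_div_iff₀ hba]; exact (min_le_right _ _).trans (min_le_left _ _)
    · rw [← le_div_iff₀ hba]; exact (min_le_right _ _).trans (min_le_right _ _)
  obtain ⟨g, g', hgs, hg'c, hg, hgap⟩ := exists_smooth_approx a b hab.le γ _ hfc hγ δ hδ
  obtain ⟨k, hks, hk0, hksupp, hkc, hk1⟩ := exists_kernel h hh
  obtain ⟨η, hηs, hη0, hη, hηsupp, hηc, hη1⟩ :=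
    exists_plateau h k hks hk0 hksupp hk1 a (b - h) (by linarith)
  have hgc := hgs.continuous
  have hkcont := hks.continuous
  have kc : ∀ s, HasCompactSupport (fun x => k (x - s)) := fun s =>
    hkc.comp_homeomorph (Homeomorph.subRight s)
  have kcont : ∀ s, Continuous (fun x => k (x - s)) := fun s => by fun_prop
  have kint : ∀ s, ∫ x, k (x - s) = 1 := fun s => by
    rw [← hk1]; exact integral_sub_right_eq_self k s
  have hUc : Continuous (fun p : ℝ × ℝ => Φ (p.1, p.2 + g p.1)) := by fun_prop
  have hVc : Continuous (fun p : ℝ × ℝ => (Φ (p.1, p.2 + g p.1) - g' p.1)^2 / 2) := by fun_prop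
  -- the inner error term is small
  have E0 : (∫ p : ℝ × ℝ, ((Φ (p.1, p.2 + g p.1) - g' p.1)^2 / 2) * (η p.1 * k (p.2 - 0)))
      ≤ κ * ε * (b - a) := by
    have := wavg _ hVc _ _ hηs.continuous (kcont 0) hηc (kc 0) hη0 (fun x => hk0 _) 0 (κ * ε) ?_
    · rw [hη1, kint, zero_mul, sub_zero, mul_one] at this
      refine (le_abs_self _).trans (this.trans ?_)
      gcongr; linarith
    · intro x y hx hy
      have hx := hηsupp x hx
      have hxI : x ∈ Icc a b := ⟨hx.1, by linarith [hx.2]⟩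
      have hy := hksupp _ hy
      obtain ⟨g1, g2⟩ := hgap x hxI
      have := H₂ x hxI (y + g x) (by rw [abs_le] at g2 ⊢; constructor <;> linarith)
      simp only [sub_zero]
      rw [abs_of_nonneg (by positivity)]
      refine le_trans ?_ hσ2
      have : |Φ (x, y + g x) - g' x| ≤ σ := by
        rw [abs_le] at *; constructor <;> linarith
      have := sq_le_sq' (abs_le.1 this).1 (abs_le.1 this).2
      linarith
  have Epos : ∀ s, 0 ≤ (∫ p : ℝ × ℝ, ((Φ (p.1, p.2 + g p.1) - g' p.1)^2 / 2) * (η p.1 * k (p.2 - s))) :=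
    fun s => integral_nonneg fun p => mul_nonneg (by positivity) (mul_nonneg (hη0 _) (hk0 _))
  have key : ∀ c d, d - c = ε → -ε ≤ c → d ≤ ε →
      |ε * (Φ (a, γ a) - Φ (b, γ b))
        + (∫ p : ℝ × ℝ, ((Φ (p.1, p.2 + g p.1) - g' p.1)^2 / 2) * (η p.1 * k (p.2 - c)))
        - (∫ p : ℝ × ℝ, ((Φ (p.1, p.2 + g p.1) - g' p.1)^2 / 2) * (η p.1 * k (p.2 - d)))|
      ≤ W * ((b - a) * ε) + 2 * κ * ε := by
    intro c d hcd hc hd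
    obtain ⟨χ, hχs, hχ0, hχ, hχsupp, hχc, hχ1⟩ :=
      exists_plateau h k hks hk0 hksupp hk1 c d (by linarith)
    have hnear : ∀ x ∈ Icc a b, ∀ y, c ≤ y → y ≤ d + h → |y + g x - γ x| ≤ 3 * ε := by
      intro x hx y hy1 hy2
      have := (hgap x hx).2
      rw [abs_le] at *; constructor <;> linarith
    have A1 := wavg _ hUc _ _ (kcont a) hχs.continuous (kc a) hχc (fun x => hk0 _) hχ0
      (Φ (a, γ a)) κ (by
        intro x y hx hy
        have hx := hksupp _ hx
        have hy := hχsupp _ hy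
        have hxI : x ∈ Icc a b := ⟨by linarith, by linarith⟩
        have t1 := H₁ x hxI (y + g x) ((hnear x hxI y hy.1 hy.2).trans hε1)
        have t2 := H₃ x hxI (by rw [Real.dist_eq, abs_of_nonneg hx.1]; linarith)
        rw [Real.dist_eq] at t2
        have t2 := t2.le
        dsimp only
        rw [abs_le] at *; constructor <;> linarith)
    have A2 := wavg _ hUc _ _ (kcont (b - h)) hχs.continuous (kc (b - h)) hχc (fun x => hk0 _) hχ0
      (Φ (b, γ b)) κ (by
        intro x y hx hy
        have hx := hksupp _ hx
        have hy := hχsupp _ hy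
        have hxI : x ∈ Icc a b := ⟨by linarith, by linarith⟩
        have t1 := H₁ x hxI (y + g x) ((hnear x hxI y hy.1 hy.2).trans hε1)
        have t2 := H₄ x hxI (by rw [Real.dist_eq, abs_lt]; constructor <;> linarith)
        rw [Real.dist_eq] at t2
        have t2 := t2.le
        dsimp only
        rw [abs_le] at *; constructor <;> linarith)
    rw [kint, hχ1, hcd, one_mul] at A1 A2
    obtain ⟨ψ, hψ⟩ : ∃ ψ : ℝ × ℝ → ℝ, ψ = fun p : ℝ × ℝ => η p.1 * χ (p.2 - g p.1) := ⟨_, rfl⟩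
    have hψs : ContDiff ℝ (⊤ : ℕ∞) ψ := by
      rw [hψ]
      exact (hηs.comp contDiff_fst).mul (hχs.comp (contDiff_snd.sub (hgs.comp contDiff_fst)))
    have hψ0 : ∀ p, 0 ≤ ψ p := fun p => by rw [hψ]; exact mul_nonneg (hη0 _) (hχ0 _)
    have hψt : tsupport ψ ⊆ {p : ℝ × ℝ | (a ≤ p.1 ∧ p.1 ≤ b) ∧ (c ≤ p.2 - g p.1 ∧ p.2 - g p.1 ≤ d + h)} := by
      refine closure_minimal ?_ ?_
      · intro p hp
        have hp : η p.1 * χ (p.2 - g p.1) ≠ 0 := by rw [hψ] at hp; exact hp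
        have t1 := hηsupp _ (left_ne_zero_of_mul hp)
        exact ⟨⟨t1.1, by linarith [t1.2]⟩, hχsupp _ (right_ne_zero_of_mul hp)⟩
      · refine IsClosed.and (IsClosed.and ?_ ?_) (IsClosed.and ?_ ?_)
        all_goals exact isClosed_le (by fun_prop) (by fun_prop)
    have hψt2 : ∀ p ∈ tsupport ψ, p.1 ∈ Icc a b ∧ |p.2 - γ p.1| ≤ r := by
      intro p hp
      obtain ⟨t1, t2⟩ := hψt hp
      refine ⟨t1, ?_⟩
      have := hnear p.1 t1 _ t2.1 t2.2
      rw [sub_add_cancel] at this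
      exact this.trans hε2
    have hψc : HasCompactSupport ψ := by
      let e : ℝ × ℝ ≃ₜ ℝ × ℝ :=
        { toFun := fun p => (p.1, p.2 - g p.1)
          invFun := fun p => (p.1, p.2 + g p.1)
          left_inv := fun p => by simp
          right_inv := fun p => by simp
          continuous_toFun := by fun_prop
          continuous_invFun := by fun_prop }
      have h0 : HasCompactSupport (fun p : ℝ × ℝ => η p.1 * χ p.2) := by
        refine HasCompactSupport.of_support_subset_isCompact (hηc.isCompact.prod hχc.isCompact) ?_
        intro p hp
        exact ⟨subset_tsupport _ (left_ne_zero_of_mul hp), subset_tsupport _ (right_ne_zero_of_mul hp)⟩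
      rw [hψ]
      exact h0.comp_homeomorph e
    have hψint : ∫ p, ψ p = (b - h - a) * ε := by
      rw [shear g hgc ψ hψs.continuous hψc, hψ]
      simp only [add_sub_cancel_right]
      have := wmass η χ 1
      simp only [one_mul] at this
      rw [this, hη1, hχ1, hcd]
    have main := H ψ hψs hψ0 hψt2
    rw [ident Φ hΦ η χ g g' k a (b-h) c d hηs hχs hgs hg'c hkcont hkc hη hχ hg hηc hχc ψ hψ hψs hψc,
      hψint] at main
    have : W * ((b - h - a) * ε) ≤ W * ((b - a) * ε) := by gcongr; linarith
    rw [abs_le] at *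
    constructor <;> linarith [main.1, main.2, A1.1, A1.2, A2.1, A2.2]
  have k1 := (abs_le.1 (key 0 ε (by ring) (by linarith) le_rfl)).1
  have k2 := (abs_le.1 (key (-ε) 0 (by ring) le_rfl hε.le)).2
  have p1 := Epos ε
  have p2 := Epos (-ε)
  rw [abs_le]
  constructor
  · refine le_of_mul_le_mul_left ?_ hε
    linarith
  · refine le_of_mul_le_mul_left ?_ hε
    linarith

lemma core (Φ : ℝ × ℝ → ℝ) (hΦ : Continuous Φ) (W : ℝ) (hW : 0 ≤ W) (a b : ℝ) (hab : a < b)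
    (γ : ℝ → ℝ) (hγ : ∀ s ∈ Icc a b, HasDerivAt γ (Φ (s, γ s)) s) (r : ℝ) (hr : 0 < r)
    (H : ∀ ψ : ℝ × ℝ → ℝ, ContDiff ℝ (⊤ : ℕ∞) ψ → (∀ p, 0 ≤ ψ p) →
      (∀ p ∈ tsupport ψ, p.1 ∈ Icc a b ∧ |p.2 - γ p.1| ≤ r) →
      |∫ p, (Φ p * fderiv ℝ ψ p (1, 0) + (Φ p)^2 / 2 * fderiv ℝ ψ p (0, 1))| ≤ W * ∫ p, ψ p) :
    |Φ (b, γ b) - Φ (a, γ a)| ≤ W * (b - a) := by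
  refine le_of_forall_pos_le_add fun e he => ?_
  have h2 : 0 < 2 + (b - a) := by linarith
  have := core_eps Φ hΦ W hW a b hab γ hγ r hr H (e / (2 + (b - a))) (by positivity)
  rwa [div_mul_cancel₀ _ h2.ne'] at this

lemma one_side (ω : Set (ℝ × ℝ)) (hω : IsOpen ω)
    (φ w : ℝ × ℝ → ℝ) (W : ℝ) (hW : 0 ≤ W)
    (hφc : ContinuousOn φ ω)
    (hwb : ∀ p ∈ ω, |w p| ≤ W)
    (hdistr : ∀ ψ : ℝ × ℝ → ℝ, ContDiff ℝ (⊤ : ℕ∞) ψ → HasCompactSupport ψ → tsupport ψ ⊆ ω →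
      (∫ p in ω, (φ p * fderiv ℝ ψ p (1, 0) + (φ p)^2 / 2 * fderiv ℝ ψ p (0, 1)))
        = -∫ p in ω, w p * ψ p)
    (a b : ℝ) (hab : a < b) (γ : ℝ → ℝ)
    (hγω : ∀ s ∈ Icc a b, (s, γ s) ∈ ω)
    (hγ : ∀ s ∈ Icc a b, HasDerivAt γ (φ (s, γ s)) s) :
    |φ (b, γ b) - φ (a, γ a)| ≤ W * (b - a) := by
  have hγc : ContinuousOn γ (Icc a b) := fun s hs => (hγ s hs).continuousAt.continuousWithinAt
  have hC : IsCompact ((fun z => (z, γ z)) '' Icc a b) :=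
    isCompact_Icc.image_of_continuousOn (continuousOn_id.prodMk hγc)
  have hCω : (fun z => (z, γ z)) '' Icc a b ⊆ ω := by
    rintro _ ⟨z, hz, rfl⟩; exact hγω z hz
  obtain ⟨r, hr, hrω⟩ := hC.exists_cthickening_subset_open hω hCω
  have hKc := hC.cthickening (r := r)
  set K := Metric.cthickening r ((fun z => (z, γ z)) '' Icc a b) with hK
  obtain ⟨Φ, hΦ⟩ := ContinuousMap.exists_restrict_eq hKc.isClosed
    ⟨K.domRestrict φ, (hφc.mono hrω).domRestrict⟩
  have hΦK : ∀ p ∈ K, Φ p = φ p := fun p hp => congrArg (fun F => F ⟨p, hp⟩) hΦ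
  have hmem : ∀ z ∈ Icc a b, ∀ t, |t - γ z| ≤ r → (z, t) ∈ K := by
    intro z hz t ht
    refine Metric.mem_cthickening_of_dist_le (z, t) (z, γ z) r _ (mem_image_of_mem _ hz) ?_
    rw [Prod.dist_eq]
    simp only [dist_self, Real.dist_eq]
    exact max_le hr.le ht
  have hon : ∀ z ∈ Icc a b, Φ (z, γ z) = φ (z, γ z) := fun z hz =>
    hΦK _ (hmem z hz _ (by simpa using hr.le))
  rw [← hon b (right_mem_Icc.2 hab.le), ← hon a (left_mem_Icc.2 hab.le)]
  refine core Φ Φ.continuous W hW a b hab γ (fun s hs => by rw [hon s hs]; exact hγ s hs) r hr ?_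
  intro ψ hψs hψ0 hψt
  have hψK : tsupport ψ ⊆ K := fun p hp => hmem p.1 (hψt p hp).1 p.2 (hψt p hp).2
  have hψc : HasCompactSupport ψ := hKc.of_isClosed_subset (isClosed_tsupport ψ) hψK
  have hz : ∀ p, p ∉ tsupport ψ → fderiv ℝ ψ p = 0 := fun p hp => by
    by_contra h
    exact hp (support_fderiv_subset ℝ (f := ψ) (Function.mem_support.2 h))
  have hd := hdistr ψ hψs hψc (hψK.trans hrω)
  have e1 : (∫ p in ω, (φ p * fderiv ℝ ψ p (1, 0) + (φ p)^2 / 2 * fderiv ℝ ψ p (0, 1)))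
      = ∫ p, (Φ p * fderiv ℝ ψ p (1, 0) + (Φ p)^2 / 2 * fderiv ℝ ψ p (0, 1)) := by
    refine Eq.trans ?_ (setIntegral_eq_integral_of_forall_compl_eq_zero (s := ω) ?_)
    · refine setIntegral_congr_fun hω.measurableSet fun p _ => ?_
      by_cases hp : p ∈ tsupport ψ
      · simp only [hΦK p (hψK hp)]
      · simp [hz p hp]
    · intro p hp
      have h0 : fderiv ℝ ψ p = 0 := hz p fun h => hp (hrω (hψK h))
      simp [h0]
  have hi : Integrable ψ := hψs.continuous.integrable_of_hasCompactSupport hψc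
  rw [← e1, hd, abs_neg, ← Real.norm_eq_abs, ← integral_const_mul,
    ← setIntegral_eq_integral_of_forall_compl_eq_zero (s := ω) (f := fun p => W * ψ p)]
  · refine norm_integral_le_of_norm_le (hi.const_mul W).integrableOn ?_
    refine (ae_restrict_iff' hω.measurableSet).2 (Filter.Eventually.of_forall fun p hp => ?_)
    rw [norm_mul, Real.norm_eq_abs, Real.norm_eq_abs, abs_of_nonneg (hψ0 p)]
    exact mul_le_mul_of_nonneg_right (hwb p hp) (hψ0 p)
  · intro p hp
    have : ψ p = 0 := image_eq_zero_of_notMem_tsupport fun h => hp (hrω (hψK h))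
    simp [this]

theorem stmt11 (ω : Set (ℝ × ℝ)) (hω : IsOpen ω)
    (φ w : ℝ × ℝ → ℝ) (W : ℝ) (hW : 0 ≤ W)
    (hφc : ContinuousOn φ ω) (hφb : ∃ M, ∀ p ∈ ω, |φ p| ≤ M)
    (hwb : ∀ p ∈ ω, |w p| ≤ W)
    (hdistr : ∀ ψ : ℝ × ℝ → ℝ, ContDiff ℝ (⊤ : ℕ∞) ψ → HasCompactSupport ψ → tsupport ψ ⊆ ω →
      (∫ p in ω, (φ p * fderiv ℝ ψ p (1, 0) + (φ p)^2 / 2 * fderiv ℝ ψ p (0, 1)))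
        = -∫ p in ω, w p * ψ p)
    (a b : ℝ) (hab : a ≤ b) (γ : ℝ → ℝ)
    (hγω : ∀ s ∈ Icc a b, (s, γ s) ∈ ω)
    (hγ : ∀ s ∈ Icc a b, HasDerivAt γ (φ (s, γ s)) s) :
    ∀ a' ∈ Icc a b, ∀ b' ∈ Icc a b,
      |φ (b', γ b') - φ (a', γ a')| ≤ W * |b' - a'| := by
  have key : ∀ a' ∈ Icc a b, ∀ b' ∈ Icc a b, a' < b' →
      |φ (b', γ b') - φ (a', γ a')| ≤ W * (b' - a') := by
    intro a' ha' b' hb' h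
    have hs : Icc a' b' ⊆ Icc a b := Icc_subset_Icc ha'.1 hb'.2
    exact one_side ω hω φ w W hW hφc hwb hdistr a' b' h γ (fun s hs' => hγω s (hs hs'))
      (fun s hs' => hγ s (hs hs'))
  intro a' ha' b' hb'
  rcases lt_trichotomy a' b' with h | h | h
  · rw [abs_of_pos (sub_pos.2 h)]
    exact key a' ha' b' hb' h
  · subst h; simp
  · rw [abs_sub_comm, abs_sub_comm b' a', abs_of_pos (sub_pos.2 h)]
    exact key b' hb' a' ha' h
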